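/- arXiv:1507.02638 — 2 statements merged into one kernel-verified Lean document; each statement's English description precedes it below -/
import Mathlib

section
/- Let G1 = (E1, V1, m1), G2 = (E2, V2, m2) and a nonempty I ⊆ V2 be such that G := G1 ×_I G2 is a discrete cusp, suppose deg_{G2} is constant on V2, and let θ2 satisfy Hol_{θ2} ≠ 0. Then for every a ∈ [1, ∞) there exists a weighted graph G̃1 = (Ẽ1, V1, m̃1) such that: (1) G̃ := G̃1 ×_I G2 is a discrete cusp; (2) Ẽ1(x,y) > 0 if and only if E1(x,y) > 0; (3) deg_{G̃1}(x) ≤ deg_{G1}(x) for all x ∈ V1; (4) Δ_{G̃,θ} has compact resolvent and lim_{λ→∞} N_λ(Δ_{G̃,θ}) / N_λ(deg_{G̃}(·)) = a, where N_λ(deg_{G̃}(·)) = |{v ∈ V1 × V2 : deg_{G̃}(v) ≤ λ}|. -/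
open scoped BigOperators ENNReal

noncomputable section

namespace MagneticCusp

attribute [local instance] Classical.propDecidable

variable {V V1 V2 : Type*}

/-- The axioms of a weighted graph `(E, V, m)`: `E` is symmetric, non-negative,
with no loops, `m` is a positive weight, and the graph is locally finite. -/
def GraphAxioms (E : V → V → ℝ) (m : V → ℝ) : Prop :=
  (∀ x y, E x y = E y x) ∧ (∀ x y, 0 ≤ E x y) ∧ (∀ x, E x x = 0) ∧ (∀ x, 0 < m x) ∧
    ∀ x, {y | 0 < E x y}.Finite

/-- Connectedness of the graph with edge weight `E`. -/
def Conn (E : V → V → ℝ) : Prop :=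
  ∀ x y, Relation.ReflTransGen (fun a b => 0 < E a b) x y

/-- A (real representative of a) magnetic potential: antisymmetric, vanishing off edges. -/
def MagneticPotential (E θ : V → V → ℝ) : Prop :=
  (∀ x y, θ y x = -θ x y) ∧ ∀ x y, E x y = 0 → θ x y = 0

/-- `γ` is a cycle of length `N` in the graph with edge weight `E`. -/
def IsCycle (E : V → V → ℝ) (γ : ℕ → V) (N : ℕ) : Prop :=
  γ N = γ 0 ∧ ∀ i < N, 0 < E (γ i) (γ (i + 1))

/-- The holonomy (flux) of the magnetic potential `θ` along `γ` (a real representative;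
it is to be considered modulo `2π`). -/
def hol (θ : V → V → ℝ) (γ : ℕ → V) (N : ℕ) : ℝ :=
  ∑ i ∈ Finset.range N, θ (γ i) (γ (i + 1))

/-- `Hol_θ = 0`: every cycle has vanishing holonomy in `ℝ/2πℤ`. -/
def HolTrivial (E θ : V → V → ℝ) : Prop :=
  ∀ (γ : ℕ → V) (N : ℕ), IsCycle E γ N → ∃ k : ℤ, hol θ γ N = 2 * Real.pi * k

/-- The magnetic Laplacian `Δ_{G,θ}` acting on functions. -/
def lap (E : V → V → ℝ) (m : V → ℝ) (θ : V → V → ℝ) (f : V → ℂ) (x : V) : ℂ :=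
  ((m x : ℝ) : ℂ)⁻¹ *
    ∑' y, ((E x y : ℝ) : ℂ) * (f x - Complex.exp (((θ x y : ℝ) : ℂ) * Complex.I) * f y)

/-- The magnetic quadratic form `Q_{G,θ}`. -/
def quadForm (E θ : V → V → ℝ) (f : V → ℂ) : ℝ :=
  (1 / 2) * ∑' x, ∑' y, E x y * ‖f x - Complex.exp (((θ x y : ℝ) : ℂ) * Complex.I) * f y‖ ^ 2

/-- The degree `deg_G(x) = m(x)⁻¹ Σ_y E(x,y)`. -/
def degree (E : V → V → ℝ) (m : V → ℝ) (x : V) : ℝ := (m x)⁻¹ * ∑' y, E x y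

/-- The squared norm of `f` in `ℓ²(V,m)`. -/
def nrmSq (m : V → ℝ) (f : V → ℂ) : ℝ := ∑' x, m x * ‖f x‖ ^ 2

/-- Membership in `ℓ²(V,m)`. -/
def MemL2 (m : V → ℝ) (f : V → ℂ) : Prop := Summable fun x => m x * ‖f x‖ ^ 2

/-- The quadratic form `⟨f, deg_G(·) f⟩` of the multiplication operator by the degree. -/
def degForm (E : V → V → ℝ) (m : V → ℝ) (f : V → ℂ) : ℝ :=
  ∑' x, m x * degree E m x * ‖f x‖ ^ 2

/-- Weight of the product of two weighted graphs. -/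
def prodM (m1 : V1 → ℝ) (m2 : V2 → ℝ) : V1 × V2 → ℝ := fun p => m1 p.1 * m2 p.2

/-- Edge weight of the product of `G1` by `G2` through `I ⊆ V2`. -/
def prodE (E1 : V1 → V1 → ℝ) (E2 : V2 → V2 → ℝ) (I : Set V2) :
    V1 × V2 → V1 × V2 → ℝ := fun p q =>
  (if p.2 = q.2 ∧ p.2 ∈ I then E1 p.1 q.1 else 0) + (if p.1 = q.1 then E2 p.2 q.2 else 0)

/-- Edge weight of the Cartesian product of `G1` by `G2`. -/
def cartE (E1 : V1 → V1 → ℝ) (m1 : V1 → ℝ) (E2 : V2 → V2 → ℝ) (m2 : V2 → ℝ) :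
    V1 × V2 → V1 × V2 → ℝ := fun p q =>
  (if p.2 = q.2 then E1 p.1 q.1 * m2 p.2 else 0) + (if p.1 = q.1 then m1 p.1 * E2 p.2 q.2 else 0)

/-- Magnetic potential of the product of `G1` by `G2`. -/
def prodTheta (θ1 : V1 → V1 → ℝ) (θ2 : V2 → V2 → ℝ) : V1 × V2 → V1 × V2 → ℝ := fun p q =>
  (if p.2 = q.2 then θ1 p.1 q.1 else 0) + (if p.1 = q.1 then θ2 p.2 q.2 else 0)

/-- Hypothesis (H1): `m1(x) → 0` as `x → ∞` (on an infinite vertex set). -/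
def H1cond (m1 : V1 → ℝ) : Prop :=
  Infinite V1 ∧ ∀ ε : ℝ, 0 < ε → {x : V1 | ε ≤ m1 x}.Finite

/-- Hypothesis (H3): the degree of `G1` is bounded. -/
def H3cond (E1 : V1 → V1 → ℝ) (m1 : V1 → ℝ) : Prop :=
  ∃ d : ℝ, ∀ x, degree E1 m1 x ≤ d

/-- The quadratic form of the operator `m1⁻¹(·) ⊗ Δ_{G2,θ2}` on `ℓ²(V1 × V2, m1 ⊗ m2)`:
`⟨f, (m1⁻¹(·) ⊗ Δ_{G2,θ2}) f⟩ = Σ_x Q_{G2,θ2}(f(x,·))`. -/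
def fiberForm (E2 θ2 : V2 → V2 → ℝ) (f : V1 × V2 → ℂ) : ℝ :=
  ∑' x : V1, quadForm E2 θ2 fun y => f (x, y)

/-- A simple cycle: closed walk of length `≥ 3` with pairwise distinct vertices. -/
def IsSimpleCycle (E : V → V → ℝ) (γ : ℕ → V) (N : ℕ) : Prop :=
  3 ≤ N ∧ γ N = γ 0 ∧ (∀ i < N, 0 < E (γ i) (γ (i + 1))) ∧
    ∀ i < N, ∀ j < N, γ i = γ j → i = j

/-- The weighted length of an edge, `L_G(x,y) = sqrt(min(m x, m y)/E x y)`. -/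
def edgeLength (E : V → V → ℝ) (m : V → ℝ) (x y : V) : ℝ :=
  Real.sqrt (min (m x) (m y) / E x y)

/-- The weighted length of a cycle. -/
def cycleLength (E : V → V → ℝ) (m : V → ℝ) (γ : ℕ → V) (N : ℕ) : ℝ :=
  ∑ i ∈ Finset.range N, edgeLength E m (γ i) (γ (i + 1))

/-- The (weighted) girth: infimum of the weighted lengths of simple cycles (`∞` if none). -/
def girth (E : V → V → ℝ) (m : V → ℝ) : ℝ≥0∞ :=
  ⨅ c : {c : (ℕ → V) × ℕ // IsSimpleCycle E c.1 c.2},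
    ENNReal.ofReal (cycleLength E m c.1.1 c.1.2)

/-- The radius of injectivity: half the girth. -/
def injRad (E : V → V → ℝ) (m : V → ℝ) : ℝ≥0∞ := girth E m / 2

/-- Min-max encoding: there is an `n`-dimensional subspace of finitely supported
functions (the form core) on which `Q ≤ lam ‖·‖²_{ℓ²(V,m)}`.  For the self-adjoint
operator associated to the form `Q` with form core `C_c(V)` this says
`N_lam(H) = dim ran 1_{(-∞,lam]}(H) ≥ n`. -/
def DimGE (Q : (V → ℂ) → ℝ) (m : V → ℝ) (lam : ℝ) (n : ℕ) : Prop :=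
  ∃ g : Fin n → V → ℂ, LinearIndependent ℂ g ∧
    (∀ i, (Function.support (g i)).Finite) ∧
    ∀ f ∈ Submodule.span ℂ (Set.range g), Q f ≤ lam * nrmSq m f

/-- Compact resolvent (equivalently: empty essential spectrum) of the non-negative
self-adjoint operator associated to the form `Q`, encoded via min-max:
`N_lam(H) < ∞` for every `lam`. -/
def CompactResolvent (Q : (V → ℂ) → ℝ) (m : V → ℝ) : Prop :=
  ∀ lam : ℝ, ∃ n : ℕ, ∀ k : ℕ, DimGE Q m lam k → k ≤ n

/-- The eigenvalue counting function `N_lam(H) = dim ran 1_{(-∞,lam]}(H)`,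
encoded via min-max over the form core. -/
def countEig (Q : (V → ℂ) → ℝ) (m : V → ℝ) (lam : ℝ) : ℕ :=
  sSup {k : ℕ | DimGE Q m lam k}

/-- The `n`-th eigenvalue (counted with multiplicity, `n` starting at `0`) of the
self-adjoint operator associated to `Q`, via the Courant min-max principle. -/
def eigVal (Q : (V → ℂ) → ℝ) (m : V → ℝ) (n : ℕ) : ℝ :=
  sInf {t : ℝ | DimGE Q m t (n + 1)}

/-- Equality of the form domains of the two non-negative forms `Q1`, `Q2`, both with
form core the finitely supported functions: by the closed graph theorem this is
equivalent to the equivalence of the form norms on the common core. -/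
def SameFormDomain (Q1 Q2 : (V → ℂ) → ℝ) (m : V → ℝ) : Prop :=
  ∃ c1 c2 : ℝ, 0 < c1 ∧ 0 < c2 ∧ ∀ f : V → ℂ, (Function.support f).Finite →
    c1 * (nrmSq m f + Q1 f) ≤ nrmSq m f + Q2 f ∧
      nrmSq m f + Q2 f ≤ c2 * (nrmSq m f + Q1 f)

/-- The matrix of the magnetic Laplacian after the unitary rescaling `f ↦ √m f`. -/
def magMatrix (E : V → V → ℝ) (m : V → ℝ) (θ : V → V → ℝ) : Matrix V V ℂ := fun x y =>
  (if x = y then ((degree E m x : ℝ) : ℂ) else 0) -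
    ((E x y : ℝ) : ℂ) * Complex.exp (((θ x y : ℝ) : ℂ) * Complex.I) /
      (((√(m x) : ℝ) : ℂ) * ((√(m y) : ℝ) : ℂ))

theorem magMatrix_isHermitian {E : V → V → ℝ} {m : V → ℝ} {θ : V → V → ℝ}
    (hG : GraphAxioms E m) (hθ : MagneticPotential E θ) : (magMatrix E m θ).IsHermitian := by
  ext x y
  simp only [Matrix.conjTranspose_apply, magMatrix, star_sub, RCLike.star_def]
  congr 1
  · by_cases h : x = y
    · subst h; simp
    · simp [h, Ne.symm h]
  · rw [hG.1 y x, hθ.1 x y]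
    simp only [map_div₀, map_mul, Complex.conj_ofReal, ← Complex.exp_conj, Complex.conj_I]
    rw [mul_comm ((√(m y) : ℝ) : ℂ)]
    congr 3
    push_cast; ring

theorem hermitian_form_eq [Fintype V] {A : Matrix V V ℂ} (hA : A.IsHermitian) (v : V → ℂ) :
    (∑ x, (starRingEnd ℂ) (v x) * ∑ y, A x y * v y).re =
      ∑ j, hA.eigenvalues j * ‖hA.eigenvectorBasis.repr (WithLp.toLp 2 v) j‖ ^ 2 := by
  set b := hA.eigenvectorBasis
  set w : EuclideanSpace ℂ V := WithLp.toLp 2 v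
  have hsym : (Matrix.toEuclideanLin A).IsSymmetric := Matrix.isSymmetric_toEuclideanLin_iff.2 hA
  have h1 : ∑ x, (starRingEnd ℂ) (v x) * ∑ y, A x y * v y
      = inner ℂ w (Matrix.toEuclideanLin A w) := by
    rw [PiLp.inner_apply]
    refine Finset.sum_congr rfl fun x _ => ?_
    rw [RCLike.inner_apply, mul_comm]
    rfl
  have h2 : ∀ j, Matrix.toEuclideanLin A (b j) = (hA.eigenvalues j : ℂ) • b j := by
    intro j
    ext x
    have := congrFun (hA.mulVec_eigenvectorBasis j) x
    simpa using this
  rw [h1, ← b.sum_inner_mul_inner, Complex.re_sum]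
  refine Finset.sum_congr rfl fun j _ => ?_
  rw [← hsym, h2, inner_smul_left, b.repr_apply_apply, Complex.conj_ofReal, mul_left_comm,
    ← inner_conj_symm w, ← Complex.normSq_eq_conj_mul_self, Complex.normSq_eq_norm_sq]
  norm_cast

theorem quadForm_eq_hermitian_form [Fintype V] {E : V → V → ℝ} {m : V → ℝ} {θ : V → V → ℝ}
    (hG : GraphAxioms E m) (u : V → ℂ) :
    quadForm E θ u = (∑ x, (starRingEnd ℂ) (((√(m x) : ℝ) : ℂ) * u x) *
      ∑ y, magMatrix E m θ x y * (((√(m y) : ℝ) : ℂ) * u y)).re := by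
  have hs : ∀ x, 0 < √(m x) := fun x => Real.sqrt_pos.2 (hG.2.2.2.1 x)
  have hss : ∀ x, √(m x) * √(m x) = m x := fun x => Real.mul_self_sqrt (hG.2.2.2.1 x).le
  obtain ⟨g, hg⟩ : ∃ g : V → V → ℂ, ∀ x y, g x y = (starRingEnd ℂ) (u x) * ((E x y : ℂ) *
      Complex.exp (((θ x y : ℝ) : ℂ) * Complex.I) * u y) := ⟨_, fun _ _ => rfl⟩
  have hterm : ∀ x y, E x y * ‖u x - Complex.exp (((θ x y : ℝ) : ℂ) * Complex.I) * u y‖ ^ 2 =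
      E x y * ‖u x‖ ^ 2 + E x y * ‖u y‖ ^ 2 -
      2 * (g x y).re := by
    intro x y
    have h1 : ‖Complex.exp (((θ x y : ℝ) : ℂ) * Complex.I)‖ = 1 := Complex.norm_exp_ofReal_mul_I _
    have h2 := Complex.normSq_sub (u x) (Complex.exp (((θ x y : ℝ) : ℂ) * Complex.I) * u y)
    simp only [Complex.normSq_eq_norm_sq] at h2
    rw [h2, norm_mul, h1, one_mul, hg]
    have h3 : ((starRingEnd ℂ) (u x) * ((E x y : ℂ) *
        Complex.exp (((θ x y : ℝ) : ℂ) * Complex.I) * u y)).re =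
        E x y * (u x * (starRingEnd ℂ)
          (Complex.exp (((θ x y : ℝ) : ℂ) * Complex.I) * u y)).re := by
      rw [← Complex.conj_re (u x * _), ← Complex.re_ofReal_mul]
      congr 1
      simp only [map_mul, Complex.conj_conj]; ring
    rw [h3]; ring
  have hrow : ∀ x, (starRingEnd ℂ) (((√(m x) : ℝ) : ℂ) * u x) *
      ∑ y, magMatrix E m θ x y * (((√(m y) : ℝ) : ℂ) * u y) =
      (((∑ y, E x y) * ‖u x‖ ^ 2 : ℝ) : ℂ) - ∑ y, g x y := by
    intro x
    have hx : ((√(m x) : ℝ) : ℂ) ≠ 0 := by exact_mod_cast (hs x).ne'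
    have hd : ((√(m x) : ℝ) : ℂ) * ((√(m x) : ℝ) : ℂ) * (degree E m x : ℂ) =
        ((∑ y, E x y : ℝ) : ℂ) := by
      rw [degree, tsum_fintype]
      rw [← Complex.ofReal_mul, ← Complex.ofReal_mul, hss, mul_inv_cancel_left₀]
      exact (hG.2.2.2.1 x).ne'
    simp only [magMatrix, sub_mul, Finset.sum_sub_distrib, ite_mul, zero_mul, Finset.sum_ite_eq,
      Finset.mem_univ, if_true, mul_sub, Finset.mul_sum, map_mul, Complex.conj_ofReal]
    congr 1
    · rw [Complex.ofReal_mul, ← hd, ← Complex.normSq_eq_norm_sq, Complex.normSq_eq_conj_mul_self]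
      ring
    · refine Finset.sum_congr rfl fun y _ => ?_
      have hy : ((√(m y) : ℝ) : ℂ) ≠ 0 := by exact_mod_cast (hs y).ne'
      rw [hg]
      field_simp
  have hsymm : ∑ x, ∑ y, E x y * ‖u y‖ ^ 2 = ∑ x, ∑ y, E x y * ‖u x‖ ^ 2 := by
    rw [Finset.sum_comm]
    exact Finset.sum_congr rfl fun x _ => Finset.sum_congr rfl fun y _ => by rw [hG.1]
  rw [quadForm]
  simp only [tsum_fintype, hterm, hrow, Finset.sum_sub_distrib, Finset.sum_add_distrib,
    Complex.sub_re, Complex.re_sum, Complex.ofReal_re, hsymm, ← Finset.mul_sum, Finset.sum_mul]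
  ring

theorem quadForm_nonneg {E θ : V → V → ℝ} (hE : ∀ x y, 0 ≤ E x y) (u : V → ℂ) :
    0 ≤ quadForm E θ u :=
  mul_nonneg (by norm_num) (tsum_nonneg fun x => tsum_nonneg fun y =>
    mul_nonneg (hE x y) (sq_nonneg _))

/-- A vector annihilated by the magnetic form vanishes when the holonomy is nontrivial. -/
theorem eq_zero_of_quadForm_eq_zero [Fintype V] {E θ : V → V → ℝ}
    (hE : ∀ x y, 0 ≤ E x y) (hconn : Conn E) (hhol : ¬HolTrivial E θ) {u : V → ℂ}
    (hu : quadForm E θ u = 0) : u = 0 := by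
  have hedge : ∀ x y, 0 < E x y → u x = Complex.exp (((θ x y : ℝ) : ℂ) * Complex.I) * u y := by
    intro x y hxy
    simp only [quadForm, tsum_fintype] at hu
    have h0 : ∀ x y, 0 ≤ E x y * ‖u x - Complex.exp (((θ x y : ℝ) : ℂ) * Complex.I) * u y‖ ^ 2 :=
      fun x y => mul_nonneg (hE x y) (sq_nonneg _)
    have h1 := (mul_eq_zero.1 hu).resolve_left (by norm_num)
    rw [Finset.sum_eq_zero_iff_of_nonneg (fun x _ => Finset.sum_nonneg fun y _ => h0 x y)] at h1
    have h2 := h1 x (Finset.mem_univ _)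
    rw [Finset.sum_eq_zero_iff_of_nonneg (fun y _ => h0 x y)] at h2
    have h3 := (mul_eq_zero.1 (h2 y (Finset.mem_univ _))).resolve_left hxy.ne'
    exact sub_eq_zero.1 (norm_eq_zero.1 (pow_eq_zero_iff (two_ne_zero) |>.1 h3))
  by_contra hne
  obtain ⟨x0, hx0⟩ := Function.ne_iff.1 hne
  have hall : ∀ y, u y ≠ 0 := by
    intro y
    induction hconn x0 y with
    | refl => exact hx0
    | tail _ hbc ih =>
      intro h
      apply ih
      rw [hedge _ _ hbc, h, mul_zero]
  apply hhol
  intro γ N hγ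
  have hwalk : ∀ n ≤ N, u (γ 0) = Complex.exp (((hol θ γ n : ℝ) : ℂ) * Complex.I) * u (γ n) := by
    intro n
    induction n with
    | zero => intro _; simp [hol]
    | succ n ih =>
      intro hn
      rw [ih (by omega), hedge _ _ (hγ.2 n (by omega)), ← mul_assoc, ← Complex.exp_add]
      congr 2
      simp only [hol, Finset.sum_range_succ]
      push_cast; ring
  have h := hwalk N le_rfl
  rw [hγ.1] at h
  have h1 : Complex.exp (((hol θ γ N : ℝ) : ℂ) * Complex.I) = 1 :=
    mul_right_cancel₀ (hall (γ 0)) (by rw [one_mul]; exact h.symm)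
  obtain ⟨k, hk⟩ := Complex.exp_eq_one_iff.1 h1
  refine ⟨k, ?_⟩
  have h2 : ((hol θ γ N : ℝ) : ℂ) = ((2 * Real.pi * k : ℝ) : ℂ) := by
    apply mul_right_cancel₀ Complex.I_ne_zero
    rw [hk]; push_cast; ring
  exact_mod_cast h2

theorem exists_edge_of_not_holTrivial {E θ : V → V → ℝ} (hhol : ¬HolTrivial E θ) :
    ∃ x y, 0 < E x y := by
  by_contra! h
  apply hhol
  intro γ N hγ
  refine ⟨0, ?_⟩
  rcases Nat.eq_zero_or_pos N with rfl | hN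
  · simp [hol]
  · exact absurd (hγ.2 0 hN) (not_lt.2 (h _ _))

/-- Diagonalisation of the magnetic Laplacian on a finite graph of constant degree with
nontrivial holonomy: all eigenvalues are positive, and one is below the degree. -/
theorem exists_diagonalization [Fintype V] {E : V → V → ℝ} {m : V → ℝ} {θ : V → V → ℝ}
    (hG : GraphAxioms E m) (hθ : MagneticPotential E θ) (hconn : Conn E)
    {d : ℝ} (hd : ∀ y, degree E m y = d) (hhol : ¬HolTrivial E θ) :
    ∃ (μ : V → ℝ) (C : (V → ℂ) ≃ₗ[ℂ] (V → ℂ)), (∀ j, 0 < μ j) ∧ (∃ j, μ j < d) ∧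
      (∀ u, ∑ y, m y * ‖u y‖ ^ 2 = ∑ j, ‖C u j‖ ^ 2) ∧
      ∀ u, quadForm E θ u = ∑ j, μ j * ‖C u j‖ ^ 2 := by
  have hA := magMatrix_isHermitian hG hθ
  have hs : ∀ x, 0 < √(m x) := fun x => Real.sqrt_pos.2 (hG.2.2.2.1 x)
  have hss : ∀ x, √(m x) ^ 2 = m x := fun x => Real.sq_sqrt (hG.2.2.2.1 x).le
  have hs' : ∀ x, ((√(m x) : ℝ) : ℂ) ≠ 0 := fun x => by exact_mod_cast (hs x).ne'
  let C : (V → ℂ) ≃ₗ[ℂ] (V → ℂ) :=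
    (LinearEquiv.piCongrRight fun x => LinearEquiv.smulOfNeZero ℂ ℂ ((√(m x) : ℝ) : ℂ) (hs' x)) ≪≫ₗ
      (WithLp.linearEquiv 2 ℂ (V → ℂ)).symm ≪≫ₗ hA.eigenvectorBasis.repr.toLinearEquiv ≪≫ₗ
      WithLp.linearEquiv 2 ℂ (V → ℂ)
  have hC : ∀ u j, C u j = hA.eigenvectorBasis.repr
      (WithLp.toLp 2 fun x => ((√(m x) : ℝ) : ℂ) * u x) j := fun u j => rfl
  have hnorm : ∀ u, ∑ y, m y * ‖u y‖ ^ 2 = ∑ j, ‖C u j‖ ^ 2 := by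
    intro u
    simp only [hC]
    rw [← EuclideanSpace.norm_sq_eq, LinearIsometryEquiv.norm_map, EuclideanSpace.norm_sq_eq]
    refine Finset.sum_congr rfl fun y _ => ?_
    simp only [norm_mul, mul_pow, Complex.norm_real, Real.norm_eq_abs, sq_abs, hss]
  have hquad : ∀ u, quadForm E θ u = ∑ j, hA.eigenvalues j * ‖C u j‖ ^ 2 := fun u => by
    rw [quadForm_eq_hermitian_form hG u,
      hermitian_form_eq hA fun x => ((√(m x) : ℝ) : ℂ) * u x]
    rfl
  refine ⟨hA.eigenvalues, C, fun j => ?_, ?_, hnorm, hquad⟩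
  · set u := C.symm (Pi.single j 1) with hu
    have h1 : quadForm E θ u = hA.eigenvalues j := by
      rw [hquad, hu, LinearEquiv.apply_symm_apply,
        Finset.sum_eq_single j (fun i _ hi => by simp [hi]) (by simp)]
      simp
    rw [← h1]
    refine (quadForm_nonneg hG.2.1 u).lt_of_ne fun h0 => ?_
    have := eq_zero_of_quadForm_eq_zero hG.2.1 hconn hhol h0.symm
    rw [hu, LinearEquiv.map_eq_zero_iff] at this
    simpa using congrFun this j
  · by_contra! hge
    obtain ⟨a, b, hab⟩ := exists_edge_of_not_holTrivial hhol
    have hne : a ≠ b := by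
      rintro rfl
      exact hab.ne' (hG.2.2.1 a)
    have htr : ∑ j, hA.eigenvalues j = ∑ _j : V, d := by
      have h1 := hA.trace_eq_sum_eigenvalues
      have h2 : (magMatrix E m θ).trace = ∑ _j : V, (d : ℂ) := by
        refine Finset.sum_congr rfl fun y _ => ?_
        simp [magMatrix, hd, hG.2.2.1]
      rw [h2] at h1
      apply Complex.ofReal_injective
      push_cast
      exact h1.symm
    have hconst : ∀ j, hA.eigenvalues j = d := fun j =>
      ((Finset.sum_eq_sum_iff_of_le fun j _ => hge j).1 htr.symm j (Finset.mem_univ j)).symm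
    have hdiag : magMatrix E m θ = (d : ℂ) • (1 : Matrix V V ℂ) := by
      rw [hA.spectral_theorem]
      have : Matrix.diagonal (RCLike.ofReal ∘ hA.eigenvalues) = (d : ℂ) • (1 : Matrix V V ℂ) := by
        rw [Matrix.smul_one_eq_diagonal]
        congr 1
        ext j
        simp [hconst]
      rw [this, map_smul, map_one]
    have hentry := congrFun (congrFun hdiag a) b
    simp [magMatrix, hne, hab.ne', hs'] at hentry

theorem GraphAxioms.hasSum_row {E : V → V → ℝ} {m : V → ℝ} (hG : GraphAxioms E m) (x : V) :
    HasSum (E x) (m x * degree E m x) := by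
  have hs : Summable (E x) := summable_of_hasFiniteSupport <| (hG.2.2.2.2 x).subset fun y hy =>
    (hG.2.1 x y).lt_of_ne' hy
  rw [degree, mul_inv_cancel_left₀ (hG.2.2.2.1 x).ne']
  exact hs.hasSum

theorem GraphAxioms.sum_row_le {E : V → V → ℝ} {m : V → ℝ} (hG : GraphAxioms E m) {d : ℝ}
    (hd : ∀ x, degree E m x ≤ d) (T : Finset V) (x : V) : ∑ y ∈ T, E x y ≤ m x * d :=
  (sum_le_hasSum T (fun y _ => hG.2.1 x y) (hG.hasSum_row x)).trans
    (mul_le_mul_of_nonneg_left (hd x) (hG.2.2.2.1 x).le)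

/-- The degree of the product graph is, up to a bounded error, the degree of the fibre. -/
theorem degree_prod_bounds [Fintype V2] {E1 : V1 → V1 → ℝ} {m1 : V1 → ℝ}
    {E2 : V2 → V2 → ℝ} {m2 : V2 → ℝ} (I : Set V2)
    (hG1 : GraphAxioms E1 m1) (hG2 : GraphAxioms E2 m2) {d d2 K : ℝ} (hd0 : 0 ≤ d)
    (hd : ∀ x, degree E1 m1 x ≤ d) (hd2 : ∀ y, degree E2 m2 y = d2)
    (hK : ∀ y, 2 * d ≤ K * m2 y) (p : V1 × V2) :
    d2 / m1 p.1 ≤ degree (prodE E1 E2 I) (prodM m1 m2) p ∧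
      degree (prodE E1 E2 I) (prodM m1 m2) p ≤ d2 / m1 p.1 + K := by
  obtain ⟨x, y⟩ := p
  have hm1 := hG1.2.2.2.1 x
  have hm2 := hG2.2.2.2.1 y
  have hsum : HasSum (prodE E1 E2 I (x, y))
      ((if y ∈ I then m1 x * degree E1 m1 x else 0) + m2 y * d2) := by
    refine HasSum.add ?_ ?_
    · have hinj : Function.Injective fun x' : V1 => (x', y) := fun a b h => (Prod.ext_iff.1 h).1
      rw [← hinj.hasSum_iff]
      · by_cases hy : y ∈ I
        · simpa [hy, Function.comp_def] using hG1.hasSum_row x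
        · simp [hy, Function.comp_def, hasSum_zero]
      · rintro ⟨x', y'⟩ h
        have : y ≠ y' := by rintro rfl; exact h ⟨x', rfl⟩
        simp [this]
    · have hinj : Function.Injective fun y' : V2 => (x, y') := fun a b h => (Prod.ext_iff.1 h).2
      rw [← hinj.hasSum_iff]
      · simpa [Function.comp_def, hd2] using hG2.hasSum_row y
      · rintro ⟨x', y'⟩ h
        have : x ≠ x' := by rintro rfl; exact h ⟨y', rfl⟩
        simp [this]
  have hdeg0 : 0 ≤ degree E1 m1 x :=
    mul_nonneg (inv_nonneg.2 hm1.le) (tsum_nonneg fun y => hG1.2.1 x y)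
  have hval : degree (prodE E1 E2 I) (prodM m1 m2) (x, y) =
      d2 / m1 x + (if y ∈ I then degree E1 m1 x / m2 y else 0) := by
    rw [degree, hsum.tsum_eq, prodM]
    split_ifs <;> field_simp <;> ring
  have hb : degree E1 m1 x / m2 y ≤ K := by
    rw [div_le_iff₀ hm2]
    linarith [hd x, hK y]
  have hb0 : 0 ≤ degree E1 m1 x / m2 y := div_nonneg hdeg0 hm2.le
  rw [hval]
  split_ifs
  · exact ⟨by linarith, by linarith⟩
  · exact ⟨by linarith, by linarith⟩

/-- On finitely supported functions the form of the product is, up to a bounded error, the sum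
of the forms of the fibres. -/
theorem prod_form_bounds [Fintype V2] {E1 : V1 → V1 → ℝ} {m1 : V1 → ℝ}
    {E2 : V2 → V2 → ℝ} {m2 : V2 → ℝ} (θ1 : V1 → V1 → ℝ) (θ2 : V2 → V2 → ℝ) (I : Set V2)
    (hG1 : GraphAxioms E1 m1) (hG2 : GraphAxioms E2 m2) {d K : ℝ}
    (hd : ∀ x, degree E1 m1 x ≤ d) (hK : ∀ y, 2 * d ≤ K * m2 y)
    {f : V1 × V2 → ℂ} (hf : (Function.support f).Finite) :
    ∃ T : Finset V1, (∀ p, p.1 ∉ T → f p = 0) ∧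
      nrmSq (prodM m1 m2) f = ∑ x ∈ T, m1 x * ∑ y, m2 y * ‖f (x, y)‖ ^ 2 ∧
      ∑ x ∈ T, quadForm E2 θ2 (fun y => f (x, y)) ≤
        quadForm (prodE E1 E2 I) (prodTheta θ1 θ2) f ∧
      quadForm (prodE E1 E2 I) (prodTheta θ1 θ2) f ≤
        ∑ x ∈ T, quadForm E2 θ2 (fun y => f (x, y)) + K * nrmSq (prodM m1 m2) f := by
  set S : Set V1 := Prod.fst '' Function.support f with hS
  have hSf : S.Finite := hf.image _
  have hTf : (S ∪ ⋃ x ∈ S, {y | 0 < E1 x y}).Finite :=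
    hSf.union (hSf.biUnion fun x _ => hG1.2.2.2.2 x)
  set T := hTf.toFinset with hT
  have hfS : ∀ p : V1 × V2, p.1 ∉ S → f p = 0 := fun p hp => by
    by_contra h
    exact hp ⟨p, h, rfl⟩
  have hST : ∀ x, x ∉ T → x ∉ S := fun x hx h => hx (hTf.mem_toFinset.2 (Or.inl h))
  have hfT : ∀ p : V1 × V2, p.1 ∉ T → f p = 0 := fun p hp => hfS p (hST _ hp)
  have hET : ∀ x x', x ∈ S → x' ∉ T → E1 x x' = 0 := fun x x' hx hx' => by
    by_contra h
    exact hx' (hTf.mem_toFinset.2 (Or.inr (Set.mem_biUnion hx ((hG1.2.1 x x').lt_of_ne' h))))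
  have hnrm : nrmSq (prodM m1 m2) f = ∑ x ∈ T, m1 x * ∑ y, m2 y * ‖f (x, y)‖ ^ 2 := by
    rw [nrmSq, tsum_eq_sum (s := T ×ˢ Finset.univ), Finset.sum_product]
    · simp only [prodM, Finset.mul_sum, mul_assoc]
    · intro p hp
      have : p.1 ∉ T := by simpa using hp
      simp [hfT p this]
  set h : V1 × V2 → V1 × V2 → ℝ := fun p q => if p.2 = q.2 ∧ p.2 ∈ I then
    E1 p.1 q.1 * ‖f p - Complex.exp (((θ1 p.1 q.1 : ℝ) : ℂ) * Complex.I) * f q‖ ^ 2 else 0 with hh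
  set v : V1 × V2 → V1 × V2 → ℝ := fun p q => if p.1 = q.1 then
    E2 p.2 q.2 * ‖f p - Complex.exp (((θ2 p.2 q.2 : ℝ) : ℂ) * Complex.I) * f q‖ ^ 2 else 0 with hv
  have hterm : ∀ p q, prodE E1 E2 I p q *
      ‖f p - Complex.exp (((prodTheta θ1 θ2 p q : ℝ) : ℂ) * Complex.I) * f q‖ ^ 2 =
      h p q + v p q := by
    rintro ⟨x, y⟩ ⟨x', y'⟩
    simp only [hh, hv, prodE, prodTheta]
    by_cases hx : x = x'
    · subst hx
      by_cases hy : y = y'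
      · subst hy
        simp [hG1.2.2.1, hG2.2.2.1]
      · simp [hy]
    · by_cases hy : y = y'
      · subst hy
        by_cases hyI : y ∈ I <;> simp [hx, hyI]
      · simp [hx, hy]
  have hh_zero : ∀ p q, p.1 ∉ T ∨ q.1 ∉ T → h p q = 0 := by
    intro p q hpq
    by_cases hp : p.1 ∈ S <;> by_cases hq : q.1 ∈ S
    · exact absurd hpq (by
        rintro (h | h)
        · exact hST _ h hp
        · exact hST _ h hq)
    · have : E1 p.1 q.1 = 0 := hET _ _ hp
        (hpq.resolve_left fun h => hST _ h hp)
      simp [hh, this]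
    · have : E1 p.1 q.1 = 0 := by
        rw [hG1.1]
        exact hET _ _ hq (hpq.resolve_right fun h => hST _ h hq)
      simp [hh, this]
    · simp [hh, hfS p hp, hfS q hq]
  have hv_zero : ∀ p q, p.1 ∉ T ∨ q.1 ∉ T → v p q = 0 := by
    intro p q hpq
    by_cases he : p.1 = q.1
    · have h1 : p.1 ∉ T := by simpa [he] using hpq
      simp [hv, hfT p h1, hfT q (he ▸ h1)]
    · simp [hv, he]
  set P : Finset (V1 × V2) := T ×ˢ Finset.univ with hP
  have hPmem : ∀ p, p ∉ P → p.1 ∉ T := fun p hp => by simpa [hP] using hp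
  have hquad : quadForm (prodE E1 E2 I) (prodTheta θ1 θ2) f =
      (1 / 2) * ∑ p ∈ P, ∑ q ∈ P, h p q + (1 / 2) * ∑ p ∈ P, ∑ q ∈ P, v p q := by
    rw [quadForm, ← mul_add, ← Finset.sum_add_distrib]
    congr 1
    simp only [hterm]
    rw [tsum_eq_sum (s := P)]
    · refine Finset.sum_congr rfl fun p _ => ?_
      rw [← Finset.sum_add_distrib, tsum_eq_sum (s := P)]
      intro q hq
      rw [hh_zero p q (Or.inr (hPmem q hq)), hv_zero p q (Or.inr (hPmem q hq)), add_zero]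
    · intro p hp
      have : ∀ q, h p q + v p q = 0 := fun q => by
        rw [hh_zero p q (Or.inl (hPmem p hp)), hv_zero p q (Or.inl (hPmem p hp)), add_zero]
      simp [this]
  have hvert : (1 / 2) * ∑ p ∈ P, ∑ q ∈ P, v p q =
      ∑ x ∈ T, quadForm E2 θ2 (fun y => f (x, y)) := by
    simp only [quadForm, tsum_fintype, ← Finset.mul_sum]
    congr 1
    rw [hP, Finset.sum_product]
    refine Finset.sum_congr rfl fun x hx => Finset.sum_congr rfl fun y _ => ?_
    rw [Finset.sum_product, Finset.sum_eq_single x]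
    · simp [hv]
    · intro x' _ hne
      simp [hv, hne.symm]
    · exact fun h => absurd hx h
  have hhor0 : ∀ p q, 0 ≤ h p q := fun p q => by
    simp only [hh]
    split_ifs
    · exact mul_nonneg (hG1.2.1 _ _) (sq_nonneg _)
    · exact le_rfl
  have hhle : ∀ p q, h p q ≤ if p.2 = q.2 then
      2 * (E1 p.1 q.1 * ‖f p‖ ^ 2) + 2 * (E1 q.1 p.1 * ‖f q‖ ^ 2) else 0 := by
    intro p q
    have hE := hG1.2.1 p.1 q.1
    by_cases he : p.2 = q.2
    · have h1 : h p q ≤ E1 p.1 q.1 *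
          ‖f p - Complex.exp (((θ1 p.1 q.1 : ℝ) : ℂ) * Complex.I) * f q‖ ^ 2 := by
        simp only [hh]
        split_ifs
        · exact le_rfl
        · exact mul_nonneg hE (sq_nonneg _)
      have h2 : ‖f p - Complex.exp (((θ1 p.1 q.1 : ℝ) : ℂ) * Complex.I) * f q‖ ≤ ‖f p‖ + ‖f q‖ := by
        refine (norm_sub_le _ _).trans ?_
        rw [norm_mul, Complex.norm_exp_ofReal_mul_I, one_mul]
      have h3 : ‖f p - Complex.exp (((θ1 p.1 q.1 : ℝ) : ℂ) * Complex.I) * f q‖ ^ 2 ≤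
          2 * ‖f p‖ ^ 2 + 2 * ‖f q‖ ^ 2 := by
        have := pow_le_pow_left₀ (norm_nonneg _) h2 2
        nlinarith [sq_nonneg (‖f p‖ - ‖f q‖)]
      rw [if_pos he, hG1.1 q.1 p.1]
      refine h1.trans ((mul_le_mul_of_nonneg_left h3 hE).trans (le_of_eq ?_))
      ring
    · simp [hh, he]
  have hrow : ∑ p ∈ P, ∑ q ∈ P, (if p.2 = q.2 then E1 p.1 q.1 * ‖f p‖ ^ 2 else 0) ≤
      (d * ∑ p ∈ P, m1 p.1 * ‖f p‖ ^ 2) := by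
    rw [Finset.mul_sum]
    refine Finset.sum_le_sum fun p _ => ?_
    rw [hP, Finset.sum_product]
    simp only [Finset.sum_ite_eq, Finset.mem_univ, if_true, ← Finset.sum_mul]
    have := mul_le_mul_of_nonneg_right (hG1.sum_row_le hd T p.1) (sq_nonneg ‖f p‖)
    linarith
  have hcol : ∑ p ∈ P, ∑ q ∈ P, (if p.2 = q.2 then E1 q.1 p.1 * ‖f q‖ ^ 2 else 0) ≤
      (d * ∑ p ∈ P, m1 p.1 * ‖f p‖ ^ 2) := by
    rw [Finset.sum_comm]
    refine le_trans (le_of_eq ?_) hrow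
    exact Finset.sum_congr rfl fun p _ => Finset.sum_congr rfl fun q _ => by
      simp only [eq_comm]
  have hhor : (1 / 2) * ∑ p ∈ P, ∑ q ∈ P, h p q ≤ K * nrmSq (prodM m1 m2) f := by
    have h1 : ∑ p ∈ P, ∑ q ∈ P, h p q ≤
        2 * ∑ p ∈ P, ∑ q ∈ P, (if p.2 = q.2 then E1 p.1 q.1 * ‖f p‖ ^ 2 else 0) +
        2 * ∑ p ∈ P, ∑ q ∈ P, (if p.2 = q.2 then E1 q.1 p.1 * ‖f q‖ ^ 2 else 0) := by
      simp only [Finset.mul_sum, ← Finset.sum_add_distrib]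
      refine Finset.sum_le_sum fun p _ => Finset.sum_le_sum fun q _ => (hhle p q).trans ?_
      split_ifs <;> simp
    have h2 : 2 * (d * ∑ p ∈ P, m1 p.1 * ‖f p‖ ^ 2) ≤ K * nrmSq (prodM m1 m2) f := by
      rw [hnrm, ← mul_assoc, hP, Finset.sum_product]
      simp only [Finset.mul_sum]
      refine Finset.sum_le_sum fun x _ => Finset.sum_le_sum fun y _ => ?_
      have := mul_le_mul_of_nonneg_right (hK y)
        (mul_nonneg (hG1.2.2.2.1 x).le (sq_nonneg ‖f (x, y)‖))
      linarith
    linarith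
  refine ⟨T, hfT, hnrm, ?_, ?_⟩
  · rw [hquad, hvert]
    have : 0 ≤ ∑ p ∈ P, ∑ q ∈ P, h p q :=
      Finset.sum_nonneg fun p _ => Finset.sum_nonneg fun q _ => hhor0 p q
    linarith
  · rw [hquad, hvert]
    linarith

/-- The min-max counting of the product form is squeezed between countings of the fibre
eigenvalues. -/
theorem dimGE_bounds [Fintype V2] {E1 : V1 → V1 → ℝ} {m1 : V1 → ℝ}
    {E2 : V2 → V2 → ℝ} {m2 : V2 → ℝ} (θ1 : V1 → V1 → ℝ) {θ2 : V2 → V2 → ℝ} (I : Set V2)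
    (hG1 : GraphAxioms E1 m1) (hG2 : GraphAxioms E2 m2) {d K : ℝ}
    (hd : ∀ x, degree E1 m1 x ≤ d) (hK : ∀ y, 2 * d ≤ K * m2 y)
    {μ : V2 → ℝ} (C : (V2 → ℂ) ≃ₗ[ℂ] (V2 → ℂ))
    (hC : ∀ u, ∑ y, m2 y * ‖u y‖ ^ 2 = ∑ j, ‖C u j‖ ^ 2)
    (hQ : ∀ u, quadForm E2 θ2 u = ∑ j, μ j * ‖C u j‖ ^ 2)
    (hfin : ∀ lam : ℝ, {p : V1 × V2 | μ p.2 ≤ lam * m1 p.1}.Finite) (lam : ℝ) :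
    DimGE (quadForm (prodE E1 E2 I) (prodTheta θ1 θ2)) (prodM m1 m2) lam
      {p : V1 × V2 | μ p.2 ≤ (lam - K) * m1 p.1}.ncard ∧
    ∀ k, DimGE (quadForm (prodE E1 E2 I) (prodTheta θ1 θ2)) (prodM m1 m2) lam k →
      k ≤ {p : V1 × V2 | μ p.2 ≤ lam * m1 p.1}.ncard := by
  let D : (V1 × V2 → ℂ) ≃ₗ[ℂ] (V1 × V2 → ℂ) :=
    LinearEquiv.curry ℂ ℂ V1 V2 ≪≫ₗ (LinearEquiv.piCongrRight fun _ => C) ≪≫ₗ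
      (LinearEquiv.curry ℂ ℂ V1 V2).symm
  have hD : ∀ f x j, D f (x, j) = C (fun y => f (x, y)) j := fun _ _ _ => rfl
  have hDs : ∀ f x y, D.symm f (x, y) = C.symm (fun j => f (x, j)) y := fun _ _ _ => rfl
  constructor
  · set S := {p : V1 × V2 | μ p.2 ≤ (lam - K) * m1 p.1} with hS
    have hSfin : S.Finite := hfin _
    have : Finite S := hSfin
    let e : Fin S.ncard ≃ S := (Finite.equivFinOfCardEq rfl).symm
    let g : Fin S.ncard → V1 × V2 → ℂ := fun i => D.symm (Pi.single (e i : V1 × V2) 1)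
    have hsupp : ∀ i, (Function.support (g i)).Finite := by
      intro i
      refine ((Set.finite_singleton (e i : V1 × V2).1).prod Set.finite_univ).subset ?_
      rintro ⟨x, y⟩ hxy
      simp only [Set.mem_prod, Set.mem_singleton_iff, Set.mem_univ, and_true]
      by_contra hne
      apply hxy
      simp only [g, hDs]
      have : (fun j => (Pi.single (e i : V1 × V2) 1 : V1 × V2 → ℂ) (x, j)) = 0 := by
        ext j
        rw [Pi.single_eq_of_ne]
        · rfl
        · intro h
          exact hne (congrArg Prod.fst h)
      rw [this, map_zero]; rfl
    refine ⟨g, ?_, hsupp, ?_⟩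
    · have h1 : LinearIndependent ℂ fun p : V1 × V2 => (Pi.single p 1 : V1 × V2 → ℂ) :=
        Pi.linearIndependent_single_one _ _
      have h2 := h1.comp (fun i => (e i : V1 × V2))
        (Subtype.val_injective.comp e.injective)
      exact h2.map' D.symm.toLinearMap D.symm.ker
    · intro f hf
      have hfs : (Function.support f).Finite ∧ ∀ p, p ∉ S → D f p = 0 := by
        induction hf using Submodule.span_induction with
        | mem f hf =>
          obtain ⟨i, rfl⟩ := hf
          refine ⟨hsupp i, fun p hp => ?_⟩
          simp only [g, LinearEquiv.apply_symm_apply]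
          rw [Pi.single_eq_of_ne]
          rintro rfl
          exact hp (e i).2
        | zero => simp
        | add f g _ _ hf hg =>
          refine ⟨(hf.1.union hg.1).subset (Function.support_add f g), fun p hp => ?_⟩
          rw [map_add, Pi.add_apply, hf.2 p hp, hg.2 p hp, add_zero]
        | smul a f _ hf =>
          refine ⟨hf.1.subset (Function.support_const_smul_subset a f), fun p hp => ?_⟩
          rw [map_smul, Pi.smul_apply, hf.2 p hp, smul_zero]
      obtain ⟨T, -, hn, -, hup⟩ := prod_form_bounds θ1 θ2 I hG1 hG2 hd hK hfs.1
      refine hup.trans ?_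
      suffices h : ∑ x ∈ T, quadForm E2 θ2 (fun y => f (x, y)) ≤
          (lam - K) * nrmSq (prodM m1 m2) f by linarith
      rw [hn, Finset.mul_sum]
      refine Finset.sum_le_sum fun x _ => ?_
      rw [hQ, hC, Finset.mul_sum, Finset.mul_sum]
      refine Finset.sum_le_sum fun j _ => ?_
      rw [← hD, ← mul_assoc]
      by_cases hp : (x, j) ∈ S
      · exact mul_le_mul_of_nonneg_right hp (sq_nonneg _)
      · simp [hfs.2 _ hp]
  · rintro k ⟨g, hg, hsupp, hle⟩
    set S := {p : V1 × V2 | μ p.2 ≤ lam * m1 p.1} with hS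
    have hSfin : S.Finite := hfin _
    have : Fintype S := hSfin.fintype
    by_contra! hk
    let F : (Fin k → ℂ) →ₗ[ℂ] (S → ℂ) :=
      LinearMap.funLeft ℂ ℂ Subtype.val ∘ₗ D.toLinearMap ∘ₗ Fintype.linearCombination ℂ g
    have hker : LinearMap.ker F ≠ ⊥ := by
      apply LinearMap.ker_ne_bot_of_finrank_lt
      rw [Module.finrank_fintype_fun_eq_card, Module.finrank_fintype_fun_eq_card, Fintype.card_fin,
        ← Nat.card_eq_fintype_card]
      exact hk
    obtain ⟨a, ha, ha0⟩ := Submodule.exists_mem_ne_zero_of_ne_bot hker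
    set f := Fintype.linearCombination ℂ g a with hf
    have hfspan : f ∈ Submodule.span ℂ (Set.range g) := by
      rw [hf, ← Fintype.range_linearCombination]
      exact ⟨a, rfl⟩
    have hf0 : f ≠ 0 := by
      intro h0
      apply ha0
      have := Fintype.linearIndependent_iff.1 hg a (by
        rw [← Fintype.linearCombination_apply]; exact h0)
      exact funext this
    have hfS : ∀ p ∈ S, D f p = 0 := fun p hp => congrFun (LinearMap.mem_ker.1 ha) ⟨p, hp⟩
    have hfsupp : (Function.support f).Finite := by
      refine (Set.finite_iUnion hsupp).subset fun p hp => ?_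
      by_contra hn
      apply hp
      simp only [Set.mem_iUnion, Function.mem_support, not_exists, not_not] at hn
      rw [hf, Fintype.linearCombination_apply, Finset.sum_apply]
      exact Finset.sum_eq_zero fun i _ => by simp [hn i]
    obtain ⟨T, hT, hn, hlow, -⟩ := prod_form_bounds θ1 θ2 I hG1 hG2 hd hK hfsupp
    have h1 := hlow.trans (hle f hfspan)
    rw [hn, Finset.mul_sum] at h1
    have hnn : ∀ x j, 0 ≤ (μ j - lam * m1 x) * ‖D f (x, j)‖ ^ 2 := by
      intro x j
      by_cases hp : (x, j) ∈ S
      · simp [hfS _ hp]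
      · have : lam * m1 x < μ j := not_le.1 hp
        exact mul_nonneg (by linarith) (sq_nonneg _)
    have h2 : ∑ x ∈ T, ∑ j, (μ j - lam * m1 x) * ‖D f (x, j)‖ ^ 2 ≤ 0 := by
      simp only [hQ, hC, ← hD] at h1
      rw [← sub_nonpos, ← Finset.sum_sub_distrib] at h1
      refine le_trans (le_of_eq (Finset.sum_congr rfl fun x _ => ?_)) h1
      simp only [sub_mul, Finset.sum_sub_distrib, Finset.mul_sum, mul_assoc]
    have h3 := le_antisymm h2 (Finset.sum_nonneg fun x _ => Finset.sum_nonneg fun j _ => hnn x j)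
    rw [Finset.sum_eq_zero_iff_of_nonneg
      (fun x _ => Finset.sum_nonneg fun j _ => hnn x j)] at h3
    apply hf0
    rw [← D.map_eq_zero_iff]
    ext ⟨x, j⟩
    by_cases hp : (x, j) ∈ S
    · exact hfS _ hp
    · by_cases hx : x ∈ T
      · have h4 := h3 x hx
        rw [Finset.sum_eq_zero_iff_of_nonneg (fun j _ => hnn x j)] at h4
        have h5 := h4 j (Finset.mem_univ j)
        have : lam * m1 x < μ j := not_le.1 hp
        have h6 := (mul_eq_zero.1 h5).resolve_left (by linarith)
        simpa using h6
      · rw [hD]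
        have : (fun y => f (x, y)) = 0 := funext fun y => hT (x, y) hx
        rw [this, map_zero]; rfl

/-- For every `α ≥ 0` there are weights whose counting function varies regularly with
index `α`. -/
theorem exists_regularly_varying_weights {α : ℝ} (hα : 0 ≤ α) :
    ∃ (s : ℕ → ℝ) (h : ℝ → ℝ), (∀ k, 0 < s k) ∧
      (∀ t, 0 < t → ∀ k : ℕ, 1 ≤ t * s k ↔ ((k + 1 : ℕ) : ℝ) ≤ h t) ∧
      Filter.Tendsto h Filter.atTop Filter.atTop ∧
      ∀ c, 0 < c → ∀ b,
        Filter.Tendsto (fun t => h (c * (t - b)) / h t) Filter.atTop (nhds (c ^ α)) := by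
  have hlim : ∀ c b : ℝ, Filter.Tendsto (fun t : ℝ => c * (1 - b / t)) Filter.atTop (nhds c) := by
    intro c b
    have h1 : Filter.Tendsto (fun t : ℝ => b / t) Filter.atTop (nhds 0) :=
      Filter.tendsto_id.const_div_atTop b
    simpa using (h1.const_sub 1).const_mul c
  rcases hα.eq_or_lt with rfl | hα
  · refine ⟨fun k => Real.exp (-((k + 1 : ℕ) : ℝ)), Real.log, fun k => Real.exp_pos _, ?_,
      Real.tendsto_log_atTop, ?_⟩
    · intro t ht k
      beta_reduce
      rw [Real.le_log_iff_exp_le ht, Real.exp_neg, ← div_eq_mul_inv, one_le_div (Real.exp_pos _)]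
    · intro c hc b
      rw [Real.rpow_zero]
      have h1 : Filter.Tendsto (fun t : ℝ => 1 + Real.log (c * (1 - b / t)) / Real.log t)
          Filter.atTop (nhds (1 + 0)) :=
        (((hlim c b).log hc.ne').div_atTop Real.tendsto_log_atTop).const_add 1
      rw [add_zero] at h1
      refine h1.congr' ?_
      filter_upwards [Filter.eventually_gt_atTop 1, (hlim c b).eventually (lt_mem_nhds hc)]
        with t ht hpos
      have ht0 : 0 < t := by linarith
      have hlog := Real.log_pos ht
      have : c * (t - b) = t * (c * (1 - b / t)) := by field_simp
      rw [this, Real.log_mul ht0.ne' hpos.ne', add_div, div_self hlog.ne']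
  · refine ⟨fun k => ((k + 1 : ℕ) : ℝ) ^ (-α⁻¹), fun t => t ^ α,
      fun k => Real.rpow_pos_of_pos (by positivity) _, ?_, tendsto_rpow_atTop hα, ?_⟩
    · intro t ht k
      have hk : (0 : ℝ) < ((k + 1 : ℕ) : ℝ) := by positivity
      beta_reduce
      rw [Real.rpow_neg hk.le, ← div_eq_mul_inv, one_le_div (Real.rpow_pos_of_pos hk _),
        Real.rpow_inv_le_iff_of_pos hk.le ht.le hα]
    · intro c hc b
      refine ((hlim c b).rpow_const (Or.inl hc.ne')).congr' ?_
      filter_upwards [Filter.eventually_gt_atTop 1, (hlim c b).eventually (lt_mem_nhds hc)]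
        with t ht hpos
      have ht0 : 0 < t := by linarith
      have : c * (t - b) = t * (c * (1 - b / t)) := by field_simp
      rw [this, Real.mul_rpow ht0.le hpos.le,
        mul_div_cancel_left₀ _ (Real.rpow_pos_of_pos ht0 _).ne']

theorem floor_regularly_varying {h F : ℝ → ℝ} {α : ℝ}
    (hF : ∀ t, 0 < t → F t = (⌊h t⌋₊ : ℝ))
    (hh : Filter.Tendsto h Filter.atTop Filter.atTop)
    (hr : ∀ c, 0 < c → ∀ b,
      Filter.Tendsto (fun t => h (c * (t - b)) / h t) Filter.atTop (nhds (c ^ α)))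
    {c : ℝ} (hc : 0 < c) (b : ℝ) :
    Filter.Tendsto (fun t => F (c * (t - b)) / F t) Filter.atTop (nhds (c ^ α)) := by
  have hFh : Filter.Tendsto (fun t => F t / h t) Filter.atTop (nhds 1) := by
    refine (tendsto_nat_floor_div_atTop.comp hh).congr' ?_
    filter_upwards [Filter.eventually_gt_atTop 0] with t ht
    rw [hF t ht]; rfl
  have hu : Filter.Tendsto (fun t : ℝ => c * (t - b)) Filter.atTop Filter.atTop :=
    (Filter.tendsto_atTop_add_const_right _ (-b) Filter.tendsto_id).const_mul_atTop hc
  have h1 := ((hFh.comp hu).mul (hr c hc b)).mul (hFh.inv₀ one_ne_zero)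
  rw [inv_one, one_mul, mul_one] at h1
  refine h1.congr' ?_
  filter_upwards [hh.eventually_gt_atTop 0, (hh.comp hu).eventually_gt_atTop 0] with t h2 h3
  have h3' : h (c * (t - b)) ≠ 0 := ne_of_gt h3
  simp only [Function.comp_apply]
  rw [div_mul_div_cancel₀ h3', inv_div, div_mul_div_cancel₀ h2.ne']

theorem ncard_setOf_prod [Fintype V2] (P : V1 → V2 → Prop) (hfin : ∀ j, {x | P x j}.Finite) :
    {p : V1 × V2 | P p.1 p.2}.Finite ∧
      {p : V1 × V2 | P p.1 p.2}.ncard = ∑ j, {x | P x j}.ncard := by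
  have hset : {p : V1 × V2 | P p.1 p.2} =
      ↑(Finset.univ.biUnion fun j => (hfin j).toFinset ×ˢ ({j} : Finset V2)) := by
    ext ⟨x, j⟩
    simp
  refine ⟨by rw [hset]; exact Finset.finite_toSet _, ?_⟩
  rw [hset, Set.ncard_coe_finset, Finset.card_biUnion]
  · refine Finset.sum_congr rfl fun j _ => ?_
    rw [Finset.card_product, Finset.card_singleton, mul_one, Set.ncard_eq_toFinset_card _ (hfin j)]
  · intro i _ j _ hij
    rw [Function.onFun, Finset.disjoint_left]
    rintro ⟨x, y⟩ h1 h2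
    simp only [Finset.mem_product, Finset.mem_singleton] at h1 h2
    exact hij (h1.2.symm.trans h2.2)

/-- A quantity squeezed between shifted fibre countings has the same asymptotics. -/
theorem tendsto_of_squeezed_count [Fintype V2] {F X : ℝ → ℝ} {α K : ℝ} {μ : V2 → ℝ}
    (hμ : ∀ j, 0 < μ j) (hF0 : ∀ t, 0 ≤ F t)
    (hF : ∀ c, 0 < c → ∀ b,
      Filter.Tendsto (fun t => F (c * (t - b)) / F t) Filter.atTop (nhds (c ^ α)))
    (hlow : ∀ t, ∑ j, F ((μ j)⁻¹ * (t - K)) ≤ X t) (hup : ∀ t, X t ≤ ∑ j, F ((μ j)⁻¹ * t)) :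
    Filter.Tendsto (fun t => X t / F t) Filter.atTop (nhds (∑ j, (μ j)⁻¹ ^ α)) := by
  have key : ∀ b, Filter.Tendsto (fun t => (∑ j, F ((μ j)⁻¹ * (t - b))) / F t) Filter.atTop
      (nhds (∑ j, (μ j)⁻¹ ^ α)) := by
    intro b
    simp only [Finset.sum_div]
    exact tendsto_finsetSum _ fun j _ => hF _ (inv_pos.2 (hμ j)) b
  have h0 := key 0
  simp only [sub_zero] at h0
  exact tendsto_of_tendsto_of_tendsto_of_le_of_le (key K) h0
    (fun t => div_le_div_of_nonneg_right (hlow t) (hF0 t))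
    (fun t => div_le_div_of_nonneg_right (hup t) (hF0 t))

theorem exists_exponent [Fintype V2] {μ : V2 → ℝ} {d : ℝ} (hμ : ∀ j, 0 < μ j)
    (hlt : ∃ j, μ j < d) {a : ℝ} (ha : 1 ≤ a) :
    ∃ α : ℝ, 0 ≤ α ∧ (∑ j, (μ j)⁻¹ ^ α) / (∑ _j : V2, d⁻¹ ^ α) = a := by
  obtain ⟨i, hi⟩ := hlt
  have hd : 0 < d := (hμ i).trans hi
  have hn : (0 : ℝ) < Fintype.card V2 := by
    have : Nonempty V2 := ⟨i⟩
    exact_mod_cast Fintype.card_pos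
  have hpos : ∀ j, 0 < d / μ j := fun j => div_pos hd (hμ j)
  have hcont : Continuous fun α : ℝ => ∑ j, (d / μ j) ^ α :=
    continuous_finsetSum _ fun j _ => Real.continuous_const_rpow (hpos j).ne'
  obtain ⟨B, hB⟩ := ((tendsto_rpow_atTop_of_base_gt_one (d / μ i)
    ((one_lt_div (hμ i)).2 hi)).eventually_ge_atTop (Fintype.card V2 * a)
    |>.and (Filter.eventually_ge_atTop 0)).exists
  have hmem : (Fintype.card V2 : ℝ) * a ∈
      Set.Icc (∑ j, (d / μ j) ^ (0 : ℝ)) (∑ j, (d / μ j) ^ B) := by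
    constructor
    · simp only [Real.rpow_zero, Finset.sum_const, Finset.card_univ, nsmul_eq_mul, mul_one]
      nlinarith
    · exact hB.1.trans (Finset.single_le_sum (f := fun j => (d / μ j) ^ B)
        (fun j _ => (Real.rpow_pos_of_pos (hpos j) B).le) (Finset.mem_univ i))
  obtain ⟨α, hα, hval⟩ := intermediate_value_Icc hB.2 hcont.continuousOn hmem
  refine ⟨α, hα.1, ?_⟩
  have hdα : 0 < d ^ α := Real.rpow_pos_of_pos hd α
  have h1 : ∀ j, (d / μ j) ^ α = d ^ α * (μ j)⁻¹ ^ α := fun j => by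
    rw [div_eq_mul_inv, Real.mul_rpow hd.le (inv_pos.2 (hμ j)).le]
  simp only [h1, ← Finset.mul_sum] at hval
  rw [Finset.sum_const, Finset.card_univ, nsmul_eq_mul, Real.inv_rpow hd.le,
    div_eq_iff (by positivity), ← mul_assoc, mul_comm a, ← hval, mul_right_comm,
    mul_inv_cancel₀ hdα.ne', one_mul]

/-- The edge weight `E` rescaled so that replacing the vertex weight `m` by `m'` does not
increase the degree. -/
def rescaledE (E : V → V → ℝ) (m m' : V → ℝ) : V → V → ℝ := fun x y =>
  E x y * min (m' x / m x) (m' y / m y)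

theorem rescaledE_pos_iff {E : V → V → ℝ} {m m' : V → ℝ} (hG : GraphAxioms E m)
    (hm' : ∀ x, 0 < m' x) (x y : V) : 0 < rescaledE E m m' x y ↔ 0 < E x y :=
  mul_pos_iff_of_pos_right
    (lt_min (div_pos (hm' x) (hG.2.2.2.1 x)) (div_pos (hm' y) (hG.2.2.2.1 y)))

theorem rescaledE_graphAxioms {E : V → V → ℝ} {m m' : V → ℝ} (hG : GraphAxioms E m)
    (hm' : ∀ x, 0 < m' x) : GraphAxioms (rescaledE E m m') m' := by
  refine ⟨fun x y => ?_, fun x y => ?_, fun x => ?_, hm', fun x => ?_⟩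
  · rw [rescaledE, rescaledE, hG.1, min_comm]
  · exact mul_nonneg (hG.2.1 x y) (le_min (div_pos (hm' x) (hG.2.2.2.1 x)).le
      (div_pos (hm' y) (hG.2.2.2.1 y)).le)
  · rw [rescaledE, hG.2.2.1, zero_mul]
  · simpa only [rescaledE_pos_iff hG hm'] using hG.2.2.2.2 x

theorem degree_rescaledE_le {E : V → V → ℝ} {m m' : V → ℝ} (hG : GraphAxioms E m)
    (hm' : ∀ x, 0 < m' x) (x : V) : degree (rescaledE E m m') m' x ≤ degree E m x := by
  have h1 : HasSum (fun y => E x y * (m' x / m x)) (m x * degree E m x * (m' x / m x)) :=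
    (hG.hasSum_row x).mul_right _
  have h2 := hasSum_le (fun y => mul_le_mul_of_nonneg_left (min_le_left _ _) (hG.2.1 x y))
    ((rescaledE_graphAxioms hG hm').hasSum_row x) h1
  have h3 : m x * degree E m x * (m' x / m x) = m' x * degree E m x := by
    have := (hG.2.2.2.1 x).ne'
    field_simp
  rw [h3] at h2
  exact le_of_mul_le_mul_left h2 (hm' x)

theorem countable_of_H1cond {m : V → ℝ} (hm : ∀ x, 0 < m x) (h : H1cond m) : Countable V := by
  rw [← Set.countable_univ_iff]
  refine (Set.countable_iUnion fun n : ℕ =>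
    (h.2 (1 / ((n : ℝ) + 1)) (by positivity)).countable).mono fun x _ => ?_
  obtain ⟨n, hn⟩ := exists_nat_one_div_lt (hm x)
  exact Set.mem_iUnion.2 ⟨n, hn.le⟩

/-- For a discrete cusp `G = G1 ×_I G2` with `deg_{G2}` constant and
`Hol_{θ2} ≠ 0`: for every `a ∈ [1,∞)` one can modify the weights of `G1` (keeping the
same edges and not increasing the degree) so that the resulting product `G̃` is a
discrete cusp, `Δ_{G̃,θ}` has compact resolvent, and
`N_λ(Δ_{G̃,θ}) / N_λ(deg_{G̃}(·)) → a` as `λ → ∞`. -/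
theorem counting_function_asymptotics_any_ratio
    [Fintype V2]
    (E1 : V1 → V1 → ℝ) (m1 : V1 → ℝ) (θ1 : V1 → V1 → ℝ)
    (E2 : V2 → V2 → ℝ) (m2 : V2 → ℝ) (θ2 : V2 → V2 → ℝ)
    (I : Set V2) (hI : I.Nonempty)
    (hG1 : GraphAxioms E1 m1) (hG2 : GraphAxioms E2 m2)
    (hθ1 : MagneticPotential E1 θ1) (hθ2 : MagneticPotential E2 θ2)
    (hconn1 : Conn E1) (hconn2 : Conn E2)
    (hH1 : H1cond m1) (hH3 : H3cond E1 m1)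
    (d2 : ℝ) (hd2 : ∀ y, degree E2 m2 y = d2)
    (hhol : ¬HolTrivial E2 θ2) :
    ∀ a : ℝ, 1 ≤ a →
      ∃ (Et : V1 → V1 → ℝ) (mt : V1 → ℝ),
        GraphAxioms Et mt ∧
        (H1cond mt ∧ H3cond Et mt) ∧
        (∀ x y, 0 < Et x y ↔ 0 < E1 x y) ∧
        (∀ x, degree Et mt x ≤ degree E1 m1 x) ∧
        CompactResolvent (quadForm (prodE Et E2 I) (prodTheta θ1 θ2)) (prodM mt m2) ∧
        Filter.Tendsto (fun lam : ℝ =>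
            (countEig (quadForm (prodE Et E2 I) (prodTheta θ1 θ2)) (prodM mt m2) lam : ℝ) /
              ({v : V1 × V2 | degree (prodE Et E2 I) (prodM mt m2) v ≤ lam}.ncard : ℝ))
          Filter.atTop (nhds a) := by
  intro a ha
  obtain ⟨μ, C, hμ, hlt, hC, hQ⟩ := exists_diagonalization hG2 hθ2 hconn2 hd2 hhol
  obtain ⟨α, hα, hratio⟩ := exists_exponent hμ hlt ha
  have hd2pos : 0 < d2 := hlt.elim fun j hj => (hμ j).trans hj
  obtain ⟨s, h, hs, hcount, hh, hvar⟩ := exists_regularly_varying_weights hα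
  have hinf : Infinite V1 := hH1.1
  have hV1 : Countable V1 := countable_of_H1cond hG1.2.2.2.1 hH1
  obtain ⟨e⟩ : Nonempty (V1 ≃ ℕ) := nonempty_equiv_of_countable
  set mt : V1 → ℝ := fun x => s (e x) with hmt
  have hmtpos : ∀ x, 0 < mt x := fun x => hs _
  set Et := rescaledE E1 m1 mt with hEt
  have hGt : GraphAxioms Et mt := rescaledE_graphAxioms hG1 hmtpos
  have hdeg : ∀ x, degree Et mt x ≤ degree E1 m1 x := degree_rescaledE_le hG1 hmtpos
  obtain ⟨d, hd0, hd⟩ : ∃ d : ℝ, 0 ≤ d ∧ ∀ x, degree Et mt x ≤ d := by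
    obtain ⟨d, hd⟩ := hH3
    exact ⟨max d 0, le_max_right _ _, fun x => (hdeg x).trans ((hd x).trans (le_max_left _ _))⟩
  obtain ⟨K, hK⟩ : ∃ K : ℝ, ∀ y, 2 * d ≤ K * m2 y := by
    obtain ⟨K, hK⟩ := (Set.finite_range fun y => 2 * d / m2 y).bddAbove
    exact ⟨K, fun y => (div_le_iff₀ (hG2.2.2.2.1 y)).1 (hK ⟨y, rfl⟩)⟩
  set F : ℝ → ℝ := fun t => ({x : V1 | 1 ≤ t * mt x}.ncard : ℝ) with hF
  have hset : ∀ t, 0 < t → {x : V1 | 1 ≤ t * mt x} = e ⁻¹' ↑(Finset.range ⌊h t⌋₊) := by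
    intro t ht
    refine Set.ext fun x => (hcount t ht (e x)).trans ?_
    rw [← Nat.le_floor_iff' (Nat.succ_ne_zero _), Set.mem_preimage, Finset.mem_coe,
      Finset.mem_range, Nat.succ_le_iff]
  have hfinF : ∀ t, {x : V1 | 1 ≤ t * mt x}.Finite := by
    intro t
    rcases lt_or_ge 0 t with ht | ht
    · rw [hset t ht]
      exact (Finset.finite_toSet _).preimage e.injective.injOn
    · refine Set.finite_empty.subset fun x hx => ?_
      have h1 := mul_nonpos_of_nonpos_of_nonneg ht (hmtpos x).le
      have h2 : 1 ≤ t * mt x := hx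
      linarith
  have hFfloor : ∀ t, 0 < t → F t = (⌊h t⌋₊ : ℝ) := by
    intro t ht
    simp only [hF]
    rw [hset t ht, Set.ncard_preimage_of_injective_subset_range e.injective (by simp),
      Set.ncard_coe_finset, Finset.card_range]
  have hF0 : ∀ t, 0 ≤ F t := fun t => Nat.cast_nonneg _
  have hFvar := fun c (hc : 0 < c) b => floor_regularly_varying hFfloor hh hvar hc b
  have hcard : ∀ ν : V2 → ℝ, (∀ j, 0 < ν j) → ∀ lam : ℝ,
      {p : V1 × V2 | ν p.2 ≤ lam * mt p.1}.Finite ∧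
      ({p : V1 × V2 | ν p.2 ≤ lam * mt p.1}.ncard : ℝ) = ∑ j, F ((ν j)⁻¹ * lam) := by
    intro ν hν lam
    have hiff : ∀ j, {x | ν j ≤ lam * mt x} = {x | 1 ≤ (ν j)⁻¹ * lam * mt x} := fun j => by
      ext x
      rw [Set.mem_ofPred_eq, Set.mem_ofPred_eq, mul_assoc, inv_mul_eq_div, one_le_div (hν j)]
    have h1 := ncard_setOf_prod (fun x j => ν j ≤ lam * mt x) fun j => by
      rw [hiff]
      exact hfinF _
    refine ⟨h1.1, ?_⟩
    rw [h1.2, Nat.cast_sum]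
    exact Finset.sum_congr rfl fun j _ => by rw [hiff]
  have hmin := dimGE_bounds θ1 I hGt hG2 hd hK C hC hQ fun lam => (hcard μ hμ lam).1
  have hbdd : ∀ lam, BddAbove {k | DimGE (quadForm (prodE Et E2 I) (prodTheta θ1 θ2))
      (prodM mt m2) lam k} := fun lam => ⟨_, fun k hk => (hmin lam).2 k hk⟩
  have hN : Filter.Tendsto (fun lam : ℝ =>
      (countEig (quadForm (prodE Et E2 I) (prodTheta θ1 θ2)) (prodM mt m2) lam : ℝ) / F lam)
      Filter.atTop (nhds (∑ j, (μ j)⁻¹ ^ α)) := by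
    refine tendsto_of_squeezed_count (K := K) hμ hF0 hFvar (fun lam => ?_) (fun lam => ?_)
    · rw [← (hcard μ hμ _).2]
      exact Nat.cast_le.2 (le_csSup (hbdd lam) (hmin lam).1)
    · rw [← (hcard μ hμ _).2]
      refine Nat.cast_le.2 (csSup_le ?_ (hmin lam).2)
      exact Set.nonempty_of_mem (x := _) (hmin lam).1
  have hbounds := degree_prod_bounds I hGt hG2 hd0 hd hd2 hK
  have hNd : Filter.Tendsto (fun lam : ℝ =>
      ({v : V1 × V2 | degree (prodE Et E2 I) (prodM mt m2) v ≤ lam}.ncard : ℝ) / F lam)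
      Filter.atTop (nhds (∑ _j : V2, d2⁻¹ ^ α)) := by
    have hsub : ∀ lam, {v : V1 × V2 | degree (prodE Et E2 I) (prodM mt m2) v ≤ lam} ⊆
        {p : V1 × V2 | d2 ≤ lam * mt p.1} := fun lam v hv =>
      (div_le_iff₀ (hmtpos v.1)).1 ((hbounds v).1.trans hv)
    have hfin := fun lam => (hcard (fun _ => d2) (fun _ => hd2pos) lam).1
    refine tendsto_of_squeezed_count (μ := fun _ => d2) (K := K) (fun _ => hd2pos) hF0 hFvar
      (fun lam => ?_) (fun lam => ?_)
    · rw [← (hcard (fun _ => d2) (fun _ => hd2pos) _).2]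
      refine Nat.cast_le.2 (Set.ncard_le_ncard (fun v hv => ?_) ((hfin lam).subset (hsub lam)))
      have h1 : d2 / mt v.1 ≤ lam - K := (div_le_iff₀ (hmtpos v.1)).2 hv
      exact (hbounds v).2.trans (by linarith)
    · rw [← (hcard (fun _ => d2) (fun _ => hd2pos) _).2]
      exact Nat.cast_le.2 (Set.ncard_le_ncard (hsub lam) (hfin lam))
  refine ⟨Et, mt, hGt, ⟨⟨hinf, fun ε hε => ?_⟩, d, hd⟩, rescaledE_pos_iff hG1 hmtpos, hdeg,
    fun lam => ⟨_, (hmin lam).2⟩, ?_⟩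
  · refine (hfinF ε⁻¹).subset fun x hx => ?_
    rw [Set.mem_ofPred_eq, inv_mul_eq_div, one_le_div hε]
    exact hx
  · have hne : (∑ _j : V2, d2⁻¹ ^ α) ≠ 0 := fun h0 => by
      rw [h0, div_zero] at hratio
      linarith
    rw [← hratio]
    refine (hN.div hNd hne).congr' ?_
    filter_upwards [Filter.eventually_gt_atTop 0, hh.eventually_ge_atTop 1] with lam hlam h1
    have hFpos : F lam ≠ 0 := by
      rw [hFfloor lam hlam]
      exact_mod_cast (Nat.floor_pos.2 h1).ne'
    exact div_div_div_cancel_right₀ hFpos _ _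

end MagneticCusp
end
end

section
/- Let G1 = (E1, V1, m1) with V1 = ℕ, m1(n) = e^{−n}, and E1(n, n+1) = E1(n+1, n) = e^{−(2n+1)/2} for all n ∈ ℕ (E1 = 0 otherwise), and let U : ℓ²(ℕ, m1) → ℓ²(ℕ, 1) be the unitary map (Uf)(n) = e^{−n/2} f(n). Then for every finitely supported g : ℕ → ℂ one has (U Δ_{G1,0} U^{−1} g)(n) = (e^{1/2} + e^{−1/2}) g(n) − g(n−1) − g(n+1) for n ≥ 1, and (U Δ_{G1,0} U^{−1} g)(0) = e^{−1/2} g(0) − g(1); that is, U Δ_{G1,0} U^{−1} equals the Laplacian Δ_{ℕ,0} of the simple graph on ℕ plus the constant e^{1/2} + e^{−1/2} − 2 plus a rank-one perturbation supported at 0. -/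
open scoped BigOperators ENNReal

noncomputable section

namespace MagneticCusp

attribute [local instance] Classical.propDecidable

variable {V V1 V2 : Type*}

/-- The edge weight of the half-line graph `G1` of the introduction:
`E1(n, n+1) = exp(-(2n+1)/2)`. -/
def G1E : ℕ → ℕ → ℝ := fun a b =>
  if b = a + 1 then Real.exp (-(2 * (a : ℝ) + 1) / 2)
  else if a = b + 1 then Real.exp (-(2 * (b : ℝ) + 1) / 2) else 0

/-- The vertex weight of the half-line graph `G1`: `m1(n) = exp(-n)`. -/
def G1m : ℕ → ℝ := fun k => Real.exp (-(k : ℝ))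

/-- The Laplacian of the simple graph on `ℕ`:
`(Δ_{ℕ,0} g)(n) = 2g(n) - g(n-1) - g(n+1)` for `n ≥ 1`, `(Δ_{ℕ,0} g)(0) = g(0) - g(1)`. -/
def lapN (g : ℕ → ℂ) (n : ℕ) : ℂ :=
  if n = 0 then g 0 - g 1 else 2 * g n - g (n - 1) - g (n + 1)

/-- Without magnetic potential, the Laplacian of `G1` at a vertex `n + 1` is a difference
along its two edges. -/
theorem lap_G1_succ (f : ℕ → ℂ) (n : ℕ) :
    lap G1E G1m (fun _ _ => 0) f (n + 1) =
      ((Real.exp (1 / 2) : ℝ) : ℂ) * (f (n + 1) - f n) +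
        ((Real.exp (-(1 / 2)) : ℝ) : ℂ) * (f (n + 1) - f (n + 2)) := by
  have hsum : ∀ y ∉ ({n, n + 2} : Finset ℕ), ((G1E (n + 1) y : ℝ) : ℂ) *
      (f (n + 1) - Complex.exp (((0 : ℝ) : ℂ) * Complex.I) * f y) = 0 := by
    intro y hy
    simp only [Finset.mem_insert, Finset.mem_singleton, not_or] at hy
    have : G1E (n + 1) y = 0 := by
      rw [G1E, if_neg (by omega), if_neg (by omega)]
    simp [this]
  have hleft : G1E (n + 1) n = Real.exp (1 / 2) * G1m (n + 1) := by
    rw [G1E, if_neg (by omega), if_pos rfl, G1m, ← Real.exp_add]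
    congr 1
    push_cast
    ring
  have hright : G1E (n + 1) (n + 2) = Real.exp (-(1 / 2)) * G1m (n + 1) := by
    rw [G1E, if_pos rfl, G1m, ← Real.exp_add]
    congr 1
    ring
  have hm : ((G1m (n + 1) : ℝ) : ℂ) ≠ 0 := Complex.ofReal_ne_zero.mpr (Real.exp_ne_zero _)
  rw [lap, tsum_eq_sum hsum, Finset.sum_pair (by omega), hleft, hright]
  simp only [Complex.ofReal_mul, Complex.ofReal_zero, zero_mul, Complex.exp_zero, one_mul]
  field_simp

/-- Without magnetic potential, the Laplacian of `G1` at the vertex `0` is a difference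
along its only edge. -/
theorem lap_G1_zero (f : ℕ → ℂ) :
    lap G1E G1m (fun _ _ => 0) f 0 = ((Real.exp (-(1 / 2)) : ℝ) : ℂ) * (f 0 - f 1) := by
  have hsum : ∀ y ≠ 1, ((G1E 0 y : ℝ) : ℂ) *
      (f 0 - Complex.exp (((0 : ℝ) : ℂ) * Complex.I) * f y) = 0 := by
    intro y hy
    have : G1E 0 y = 0 := by
      rw [G1E, if_neg (by omega), if_neg (by omega)]
    simp [this]
  rw [lap, tsum_eq_single 1 hsum]
  norm_num [G1E, G1m]

/-- The values of the conjugated Laplacian at the vertices `n + 1`. -/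
theorem conj_lap_G1_succ (g : ℕ → ℂ) (n : ℕ) :
    ((Real.exp (-((n + 1 : ℕ) : ℝ) / 2) : ℝ) : ℂ) *
        lap G1E G1m (fun _ _ => 0) (fun k => ((Real.exp ((k : ℝ) / 2) : ℝ) : ℂ) * g k) (n + 1) =
      ((Real.exp (1 / 2) + Real.exp (-(1 / 2)) : ℝ) : ℂ) * g (n + 1) - g n - g (n + 2) := by
  have hdiag : Real.exp (-((n + 1 : ℕ) : ℝ) / 2) * Real.exp (((n + 1 : ℕ) : ℝ) / 2) = 1 := by
    rw [← Real.exp_add, Real.exp_eq_one_iff]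
    ring
  have hleft : Real.exp (-((n + 1 : ℕ) : ℝ) / 2) * Real.exp (1 / 2) *
      Real.exp ((n : ℝ) / 2) = 1 := by
    rw [← Real.exp_add, ← Real.exp_add, Real.exp_eq_one_iff]
    push_cast
    ring
  have hright : Real.exp (-((n + 1 : ℕ) : ℝ) / 2) * Real.exp (-(1 / 2)) *
      Real.exp (((n + 2 : ℕ) : ℝ) / 2) = 1 := by
    rw [← Real.exp_add, ← Real.exp_add, Real.exp_eq_one_iff]
    push_cast
    ring
  replace hdiag := congrArg Complex.ofReal hdiag
  replace hleft := congrArg Complex.ofReal hleft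
  replace hright := congrArg Complex.ofReal hright
  simp only [Complex.ofReal_mul, Complex.ofReal_one] at hdiag hleft hright
  rw [lap_G1_succ, Complex.ofReal_add]
  linear_combination
    (((Real.exp (1 / 2) : ℝ) : ℂ) + ((Real.exp (-(1 / 2)) : ℝ) : ℂ)) * g (n + 1) * hdiag -
      g n * hleft - g (n + 2) * hright

/-- The value of the conjugated Laplacian at the vertex `0`. -/
theorem conj_lap_G1_zero (g : ℕ → ℂ) :
    ((Real.exp (-(0 : ℝ) / 2) : ℝ) : ℂ) *
        lap G1E G1m (fun _ _ => 0) (fun k => ((Real.exp ((k : ℝ) / 2) : ℝ) : ℂ) * g k) 0 =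
      ((Real.exp (-(1 / 2)) : ℝ) : ℂ) * g 0 - g 1 := by
  have hright : Real.exp (-(1 / 2)) * Real.exp (((1 : ℕ) : ℝ) / 2) = 1 := by
    rw [← Real.exp_add, Real.exp_eq_one_iff]
    norm_num
  replace hright := congrArg Complex.ofReal hright
  simp only [Complex.ofReal_mul, Complex.ofReal_one] at hright
  rw [lap_G1_zero]
  simp only [neg_zero, zero_div, Real.exp_zero, Nat.cast_zero, Complex.ofReal_one, one_mul]
  linear_combination -g 1 * hright

/-- Conjugating `Δ_{G1,0}` by the unitary
`U : ℓ²(ℕ,m1) → ℓ²(ℕ,1)`, `(Uf)(n) = e^{-n/2} f(n)`, gives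
`(UΔ_{G1,0}U⁻¹ g)(n) = (e^{1/2}+e^{-1/2}) g(n) - g(n-1) - g(n+1)` for `n ≥ 1` and
`(UΔ_{G1,0}U⁻¹ g)(0) = e^{-1/2} g(0) - g(1)`; that is, `UΔ_{G1,0}U⁻¹` equals
`Δ_{ℕ,0} + (e^{1/2}+e^{-1/2}-2)` plus a rank-one perturbation supported at `0`. -/
theorem halfline_conjugation (g : ℕ → ℂ) (hg : (Function.support g).Finite) :
    (∀ n : ℕ, 1 ≤ n →
      ((Real.exp (-(n : ℝ) / 2) : ℝ) : ℂ) *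
          lap G1E G1m (fun _ _ => 0)
            (fun k => ((Real.exp ((k : ℝ) / 2) : ℝ) : ℂ) * g k) n =
        ((Real.exp (1 / 2) + Real.exp (-(1 / 2)) : ℝ) : ℂ) * g n - g (n - 1) - g (n + 1)) ∧
      ((Real.exp (-(0 : ℝ) / 2) : ℝ) : ℂ) *
          lap G1E G1m (fun _ _ => 0)
            (fun k => ((Real.exp ((k : ℝ) / 2) : ℝ) : ℂ) * g k) 0 =
        ((Real.exp (-(1 / 2)) : ℝ) : ℂ) * g 0 - g 1 ∧
      ∃ c : ℝ, ∀ n : ℕ,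
        ((Real.exp (-(n : ℝ) / 2) : ℝ) : ℂ) *
            lap G1E G1m (fun _ _ => 0)
              (fun k => ((Real.exp ((k : ℝ) / 2) : ℝ) : ℂ) * g k) n =
          lapN g n + ((Real.exp (1 / 2) + Real.exp (-(1 / 2)) - 2 : ℝ) : ℂ) * g n +
            (if n = 0 then ((c : ℝ) : ℂ) * g 0 else 0) := by
  refine ⟨fun n hn => ?_, conj_lap_G1_zero g, 1 - Real.exp (1 / 2), fun n => ?_⟩
  · obtain ⟨k, rfl⟩ := Nat.exists_eq_add_of_le' hn
    exact conj_lap_G1_succ g k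
  · cases n with
    | zero =>
      rw [Nat.cast_zero, conj_lap_G1_zero, lapN, if_pos rfl, if_pos rfl]
      push_cast
      ring
    | succ k =>
      rw [conj_lap_G1_succ, lapN, if_neg k.succ_ne_zero, if_neg k.succ_ne_zero,
        Nat.add_sub_cancel]
      push_cast
      ring

end MagneticCusp
end
end
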